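/- The bulk-boundary Cheeger-type constants satisfy h_B ≤ h̄_B and h̃_B ≤ h̄_B. -/

import Mathlib

open MeasureTheory Set ENNReal

noncomputable section

/-- Weighted integral `∫_S w dμ`, valued in `[0,∞]`. -/
def wInt {d : ℕ} (μ : Measure (EuclideanSpace ℝ (Fin d)))
    (w : EuclideanSpace ℝ (Fin d) → ℝ) (S : Set (EuclideanSpace ℝ (Fin d))) : ℝ≥0∞ :=
  ∫⁻ x in S, ENNReal.ofReal (w x) ∂μ

/-- `s`-dimensional Hausdorff measure on `ℝ^d`. -/
def Hm (d : ℕ) (s : ℝ) : Measure (EuclideanSpace ℝ (Fin d)) :=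
  MeasureTheory.Measure.hausdorffMeasure s

/-- The surface measure `σ`: `(d-1)`-dimensional Hausdorff measure restricted to `∂Ω`. -/
def sigmaM (d : ℕ) (Om : Set (EuclideanSpace ℝ (Fin d))) : Measure (EuclideanSpace ℝ (Fin d)) :=
  (Hm d ((d : ℝ) - 1)).restrict (frontier Om)

/-- `|A|_α := ∫_A α dλ`. -/
def volW {d : ℕ} (α : EuclideanSpace ℝ (Fin d) → ℝ) (A : Set (EuclideanSpace ℝ (Fin d))) : ℝ≥0∞ :=
  wInt volume α A

/-- `∫_S β dσ` for subsets of `∂Ω`. -/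
def bdW {d : ℕ} (Om : Set (EuclideanSpace ℝ (Fin d))) (β : EuclideanSpace ℝ (Fin d) → ℝ)
    (S : Set (EuclideanSpace ℝ (Fin d))) : ℝ≥0∞ :=
  wInt (sigmaM d Om) β S

/-- Internal boundary `∂_I A := frontier A ∩ interior Ω`. -/
def intB {d : ℕ} (Om A : Set (EuclideanSpace ℝ (Fin d))) : Set (EuclideanSpace ℝ (Fin d)) :=
  frontier A ∩ interior Om

/-- External boundary `∂_E A := closure A ∩ ∂Ω`. -/
def extB {d : ℕ} (Om A : Set (EuclideanSpace ℝ (Fin d))) : Set (EuclideanSpace ℝ (Fin d)) :=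
  closure A ∩ frontier Om

/-- `|∂_I A|_α := ∫_{∂_I A} α dH^{d-1}`. -/
def intBW {d : ℕ} (Om : Set (EuclideanSpace ℝ (Fin d))) (α : EuclideanSpace ℝ (Fin d) → ℝ)
    (A : Set (EuclideanSpace ℝ (Fin d))) : ℝ≥0∞ :=
  wInt (Hm d ((d : ℝ) - 1)) α (intB Om A)

/-- `|∂_E A|_β := ∫_{∂_E A} β dσ`. -/
def extBW {d : ℕ} (Om : Set (EuclideanSpace ℝ (Fin d))) (β : EuclideanSpace ℝ (Fin d) → ℝ)
    (A : Set (EuclideanSpace ℝ (Fin d))) : ℝ≥0∞ :=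
  bdW Om β (extB Om A)

/-- Frontier of `S` in the subspace topology of `F`, as a subset of the ambient space:
`closure S ∩ closure (F \ S) ∩ F` (relative closure of `S` intersected with the
relative closure of its relative complement). -/
def relFrontier {X : Type*} [TopologicalSpace X] (F S : Set X) : Set X :=
  closure S ∩ closure (F \ S) ∩ F

/-- `|∂∂_E A|_β := ∫_{∂∂_E A} β dH^{d-2}`, where `∂∂_E A` is the frontier of `∂_E A` in the
subspace topology of `∂Ω`. -/
def ddEW {d : ℕ} (Om : Set (EuclideanSpace ℝ (Fin d))) (β : EuclideanSpace ℝ (Fin d) → ℝ)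
    (A : Set (EuclideanSpace ℝ (Fin d))) : ℝ≥0∞ :=
  wInt (Hm d ((d : ℝ) - 2)) β (relFrontier (frontier Om) (extB Om A))

/-- `A ⊆ Ω` is admissible if it is Borel and `∫_{closure A ∩ closure (Ω \ A) ∩ ∂Ω} β dσ = 0`. -/
def Admissible {d : ℕ} (Om : Set (EuclideanSpace ℝ (Fin d))) (β : EuclideanSpace ℝ (Fin d) → ℝ)
    (A : Set (EuclideanSpace ℝ (Fin d))) : Prop :=
  MeasurableSet A ∧ bdW Om β (closure A ∩ closure (Om \ A) ∩ frontier Om) = 0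

/-- `h_C`: volume constraint `0 < |A|_α ≤ |Ω|_α/2`. -/
def hC {d : ℕ} (Om : Set (EuclideanSpace ℝ (Fin d))) (α β : EuclideanSpace ℝ (Fin d) → ℝ) : ℝ≥0∞ :=
  sInf {r | ∃ A, A ⊆ Om ∧ Admissible Om β A ∧ 0 < volW α A ∧ volW α A ≤ volW α Om / 2 ∧
    r = intBW Om α A / volW α A}

/-- `h̃_C`: boundary-measure constraint `|∂_E A|_β ≤ |∂Ω|_β/2`. -/
def hCt {d : ℕ} (Om : Set (EuclideanSpace ℝ (Fin d))) (α β : EuclideanSpace ℝ (Fin d) → ℝ) : ℝ≥0∞ :=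
  sInf {r | ∃ A, A ⊆ Om ∧ Admissible Om β A ∧ 0 < volW α A ∧
    extBW Om β A ≤ bdW Om β (frontier Om) / 2 ∧ r = intBW Om α A / volW α A}

/-- `h̄_C`: combined constraint `|A|_α + |∂_E A|_β ≤ 1/2`. -/
def hCb {d : ℕ} (Om : Set (EuclideanSpace ℝ (Fin d))) (α β : EuclideanSpace ℝ (Fin d) → ℝ) : ℝ≥0∞ :=
  sInf {r | ∃ A, A ⊆ Om ∧ Admissible Om β A ∧ 0 < volW α A ∧
    volW α A + extBW Om β A ≤ 1 / 2 ∧ r = intBW Om α A / volW α A}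

/-- `h_J`: Jammes constant with volume constraint. -/
def hJ {d : ℕ} (Om : Set (EuclideanSpace ℝ (Fin d))) (α β : EuclideanSpace ℝ (Fin d) → ℝ) : ℝ≥0∞ :=
  sInf {r | ∃ A, A ⊆ Om ∧ Admissible Om β A ∧ 0 < extBW Om β A ∧ volW α A ≤ volW α Om / 2 ∧
    r = intBW Om α A / extBW Om β A}

/-- `h̃_J`: Jammes constant with boundary-measure constraint. -/
def hJt {d : ℕ} (Om : Set (EuclideanSpace ℝ (Fin d))) (α β : EuclideanSpace ℝ (Fin d) → ℝ) : ℝ≥0∞ :=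
  sInf {r | ∃ A, A ⊆ Om ∧ Admissible Om β A ∧ 0 < extBW Om β A ∧
    extBW Om β A ≤ bdW Om β (frontier Om) / 2 ∧ r = intBW Om α A / extBW Om β A}

/-- `h̄_J`: Jammes constant with combined constraint. -/
def hJb {d : ℕ} (Om : Set (EuclideanSpace ℝ (Fin d))) (α β : EuclideanSpace ℝ (Fin d) → ℝ) : ℝ≥0∞ :=
  sInf {r | ∃ A, A ⊆ Om ∧ Admissible Om β A ∧ 0 < extBW Om β A ∧
    volW α A + extBW Om β A ≤ 1 / 2 ∧ r = intBW Om α A / extBW Om β A}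

/-- `h_B`: bulk-boundary constant with volume constraint. -/
def hB {d : ℕ} (Om : Set (EuclideanSpace ℝ (Fin d))) (α β : EuclideanSpace ℝ (Fin d) → ℝ) : ℝ≥0∞ :=
  sInf {r | ∃ A, A ⊆ Om ∧ Admissible Om β A ∧ 0 < volW α A + extBW Om β A ∧
    volW α A ≤ volW α Om / 2 ∧ r = intBW Om α A / (volW α A + extBW Om β A)}

/-- `h̃_B`: bulk-boundary constant with boundary-measure constraint. -/
def hBt {d : ℕ} (Om : Set (EuclideanSpace ℝ (Fin d))) (α β : EuclideanSpace ℝ (Fin d) → ℝ) : ℝ≥0∞ :=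
  sInf {r | ∃ A, A ⊆ Om ∧ Admissible Om β A ∧ 0 < volW α A + extBW Om β A ∧
    extBW Om β A ≤ bdW Om β (frontier Om) / 2 ∧ r = intBW Om α A / (volW α A + extBW Om β A)}

/-- `h̄_B`: bulk-boundary constant with combined constraint. -/
def hBb {d : ℕ} (Om : Set (EuclideanSpace ℝ (Fin d))) (α β : EuclideanSpace ℝ (Fin d) → ℝ) : ℝ≥0∞ :=
  sInf {r | ∃ A, A ⊆ Om ∧ Admissible Om β A ∧ 0 < volW α A + extBW Om β A ∧
    volW α A + extBW Om β A ≤ 1 / 2 ∧ r = intBW Om α A / (volW α A + extBW Om β A)}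

/-- `h̃_E`. -/
def hEt {d : ℕ} (Om : Set (EuclideanSpace ℝ (Fin d))) (α β : EuclideanSpace ℝ (Fin d) → ℝ) : ℝ≥0∞ :=
  sInf {r | ∃ B, B ⊆ Om ∧ Admissible Om β B ∧ 0 < volW α B + extBW Om β B ∧
    extBW Om β B ≤ bdW Om β (frontier Om) / 2 ∧
    r = (intBW Om α B + ddEW Om β B) / (volW α B + extBW Om β B)}

/-- `h̄_D`: Wentzell-type constant with combined constraints. -/
def hDb {d : ℕ} (Om : Set (EuclideanSpace ℝ (Fin d))) (α β : EuclideanSpace ℝ (Fin d) → ℝ) : ℝ≥0∞ :=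
  sInf {r | ∃ A B C, A ⊆ Om ∧ B ⊆ Om ∧ C ⊆ Om ∧
    Admissible Om β A ∧ Admissible Om β B ∧ Admissible Om β C ∧
    volW α A + extBW Om β A ≤ 1 / 2 ∧ volW α B + extBW Om β B ≤ 1 / 2 ∧
    volW α C + extBW Om β C ≤ 1 / 2 ∧
    0 < volW α A ∧ 0 < volW α B + extBW Om β B ∧ 0 < extBW Om β C ∧
    r = intBW Om α A / volW α A * (intBW Om α B / (volW α B + extBW Om β B)) +
        ddEW Om β B / (volW α B + extBW Om β B) * (ddEW Om β C / extBW Om β C)}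

/-- `h̃_D`: Wentzell-type constant with boundary-measure constraints. -/
def hDt {d : ℕ} (Om : Set (EuclideanSpace ℝ (Fin d))) (α β : EuclideanSpace ℝ (Fin d) → ℝ) : ℝ≥0∞ :=
  sInf {r | ∃ A B C, A ⊆ Om ∧ B ⊆ Om ∧ C ⊆ Om ∧
    Admissible Om β A ∧ Admissible Om β B ∧ Admissible Om β C ∧
    extBW Om β A ≤ bdW Om β (frontier Om) / 2 ∧ extBW Om β B ≤ bdW Om β (frontier Om) / 2 ∧
    extBW Om β C ≤ bdW Om β (frontier Om) / 2 ∧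
    0 < volW α A ∧ 0 < volW α B + extBW Om β B ∧ 0 < extBW Om β C ∧
    r = intBW Om α A / volW α A * (intBW Om α B / (volW α B + extBW Om β B)) +
        ddEW Om β B / (volW α B + extBW Om β B) * (ddEW Om β C / extBW Om β C)}

/-- Cheeger constant of the boundary `h_C(∂Ω)`. -/
def hCbd {d : ℕ} (Om : Set (EuclideanSpace ℝ (Fin d))) (β : EuclideanSpace ℝ (Fin d) → ℝ) : ℝ≥0∞ :=
  sInf {r | ∃ C, C ⊆ frontier Om ∧ MeasurableSet C ∧ 0 < bdW Om β C ∧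
    bdW Om β C ≤ bdW Om β (frontier Om) / 2 ∧
    r = wInt (Hm d ((d : ℝ) - 2)) β (relFrontier (frontier Om) C) / bdW Om β C}

/-- Tangential gradient `∇^τ f(x) = ∇f(x) - ⟨∇f(x), N(x)⟩ N(x)` with `N = ∇φ/‖∇φ‖`. -/
def tGrad {d : ℕ} (φ f : EuclideanSpace ℝ (Fin d) → ℝ) (x : EuclideanSpace ℝ (Fin d)) :
    EuclideanSpace ℝ (Fin d) :=
  gradient f x -
    (inner ℝ (gradient f x) ((‖gradient φ x‖)⁻¹ • gradient φ x) : ℝ) •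
      ((‖gradient φ x‖)⁻¹ • gradient φ x)

section Complement

variable {d : ℕ} {Om A : Set (EuclideanSpace ℝ (Fin d))} {α β : EuclideanSpace ℝ (Fin d) → ℝ}

theorem wInt_eq_withDensity (μ : Measure (EuclideanSpace ℝ (Fin d)))
    (w : EuclideanSpace ℝ (Fin d) → ℝ) {S : Set (EuclideanSpace ℝ (Fin d))}
    (hS : MeasurableSet S) :
    wInt μ w S = μ.withDensity (fun x => ENNReal.ofReal (w x)) S :=
  (withDensity_apply _ hS).symm

theorem volW_add_volW_diff (α : EuclideanSpace ℝ (Fin d) → ℝ) (hOm : MeasurableSet Om)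
    (hA : MeasurableSet A) (hAOm : A ⊆ Om) : volW α A + volW α (Om \ A) = volW α Om := by
  simp only [volW, wInt_eq_withDensity _ _ hA, wInt_eq_withDensity _ _ hOm,
    wInt_eq_withDensity _ _ (hOm.diff hA)]
  exact (measure_add_sdiff hA.nullMeasurableSet Om).trans (by rw [union_eq_self_of_subset_left hAOm])

theorem Admissible.diff (hOm : MeasurableSet Om) (hAOm : A ⊆ Om) (hA : Admissible Om β A) :
    Admissible Om β (Om \ A) := by
  refine ⟨hOm.diff hA.1, ?_⟩
  rw [sdiff_sdiff_cancel_left hAOm, inter_comm (closure (Om \ A))]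
  exact hA.2

theorem Admissible.extBW_add_extBW_diff (hAOm : A ⊆ Om)
    (hA : Admissible Om β A) :
    extBW Om β A + extBW Om β (Om \ A) = bdW Om β (frontier Om) := by
  have hF : MeasurableSet (frontier Om) := isClosed_frontier.measurableSet
  have hS : MeasurableSet (extB Om A) := isClosed_closure.measurableSet.inter hF
  have hT : MeasurableSet (extB Om (Om \ A)) := isClosed_closure.measurableSet.inter hF
  have hUnion : extB Om A ∪ extB Om (Om \ A) = frontier Om := by
    rw [extB, extB, ← union_inter_distrib_right, ← closure_union, union_sdiff_cancel hAOm,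
      inter_eq_right]
    exact frontier_subset_closure
  have hInter : extB Om A ∩ extB Om (Om \ A) = closure A ∩ closure (Om \ A) ∩ frontier Om := by
    rw [extB, extB, ← inter_inter_distrib_right]
  have h0 := hA.2
  rw [← hInter, bdW, wInt_eq_withDensity _ _ (hS.inter hT)] at h0
  simp only [extBW, bdW, wInt_eq_withDensity _ _ hS, wInt_eq_withDensity _ _ hT,
    wInt_eq_withDensity _ _ hF]
  rw [← measure_union_add_inter _ hT, h0, add_zero, hUnion]

theorem intB_diff_subset (Om A : Set (EuclideanSpace ℝ (Fin d))) :
    intB Om (Om \ A) ⊆ intB Om A := by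
  rintro x ⟨hx, hxi⟩
  refine ⟨?_, hxi⟩
  rw [sdiff_eq] at hx
  rcases frontier_inter_subset _ _ hx with h | h
  · exact absurd hxi h.1.2
  · rw [frontier_compl] at h
    exact h.2

theorem intBW_diff_le (Om A : Set (EuclideanSpace ℝ (Fin d)))
    (α : EuclideanSpace ℝ (Fin d) → ℝ) : intBW Om α (Om \ A) ≤ intBW Om α A :=
  lintegral_mono_set (intB_diff_subset Om A)

end Complement

theorem ENNReal.le_half_of_add_eq_of_half_lt {a b c : ℝ≥0∞} (h : a + b = c) (ha : c / 2 < a) :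
    b ≤ c / 2 := by
  by_contra! hb
  have := ENNReal.add_lt_add ha hb
  rw [ENNReal.add_halves, h] at this
  exact lt_irrefl _ this

theorem ENNReal.le_of_add_eq_one_of_le_half {a b : ℝ≥0∞} (h : a + b = 1) (ha : a ≤ 1 / 2) :
    a ≤ b := by
  by_contra! hb
  have := ENNReal.add_lt_add_of_le_of_lt (ha.trans_lt (by simp)).ne ha (hb.trans_le ha)
  rw [ENNReal.add_halves, h] at this
  exact lt_irrefl _ this

theorem stmt_4 {d : ℕ} (hd : 2 ≤ d) (Om : Set (EuclideanSpace ℝ (Fin d)))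
    (hOmc : IsCompact Om) (hOmi : (interior Om).Nonempty)
    (α β : EuclideanSpace ℝ (Fin d) → ℝ)
    (hαc : Continuous α) (hα0 : ∀ x, 0 ≤ α x)
    (hβc : Continuous β) (hβ0 : ∀ x, 0 ≤ β x)
    (hvol : 0 < volW α Om) (hbd : 0 < bdW Om β (frontier Om))
    (hnorm : volW α Om + bdW Om β (frontier Om) = 1) :
    hB Om α β ≤ hBb Om α β ∧ hBt Om α β ≤ hBb Om α β := by
  have hOm := hOmc.isClosed
  have hcompl : ∀ A, A ⊆ Om → Admissible Om β A → volW α A + extBW Om β A ≤ 1 / 2 →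
      volW α A + extBW Om β A ≤ volW α (Om \ A) + extBW Om β (Om \ A) := by
    intro A hAOm hA hle
    refine ENNReal.le_of_add_eq_one_of_le_half ?_ hle
    rw [add_add_add_comm, volW_add_volW_diff α hOm.measurableSet hA.1 hAOm,
      hA.extBW_add_extBW_diff hAOm, hnorm]
  constructor <;> refine le_sInf ?_ <;> rintro r ⟨A, hAOm, hA, hpos, hle, rfl⟩
  · rcases le_or_gt (volW α A) (volW α Om / 2) with h | h
    · exact sInf_le ⟨A, hAOm, hA, hpos, h, rfl⟩
    · refine sInf_le_of_le ⟨Om \ A, sdiff_subset, hA.diff hOm.measurableSet hAOm,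
        hpos.trans_le (hcompl A hAOm hA hle), ?_, rfl⟩
        (ENNReal.div_le_div (intBW_diff_le Om A α) (hcompl A hAOm hA hle))
      exact ENNReal.le_half_of_add_eq_of_half_lt
        (volW_add_volW_diff α hOm.measurableSet hA.1 hAOm) h
  · rcases le_or_gt (extBW Om β A) (bdW Om β (frontier Om) / 2) with h | h
    · exact sInf_le ⟨A, hAOm, hA, hpos, h, rfl⟩
    · refine sInf_le_of_le ⟨Om \ A, sdiff_subset, hA.diff hOm.measurableSet hAOm,
        hpos.trans_le (hcompl A hAOm hA hle), ?_, rfl⟩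
        (ENNReal.div_le_div (intBW_diff_le Om A α) (hcompl A hAOm hA hle))
      exact ENNReal.le_half_of_add_eq_of_half_lt (hA.extBW_add_extBW_diff hAOm) h
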